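/- arXiv:2407.01766 — 5 statements merged into one kernel-verified Lean document; each statement's English description precedes it below -/
import Mathlib

section
/- Let E be an uncountable algebraically closed field, let A be an (associative, unital) E-algebra, and let M be a simple A-module whose dimension as an E-vector space is countable (at most ℵ₀). Then every A-module endomorphism φ : M → M is multiplication by a scalar: there exists c ∈ E with φ(m) = c • m for all m ∈ M. -/
open Polynomial in
/-- If `f` has empty spectrum over an algebraically closed field, every nonzero polynomial in `f`
is invertible. -/
theorem isUnit_aeval_of_spectrum_eq_empty {E R : Type*} [Field E] [IsAlgClosed E]
    [Ring R] [Algebra E R] {f : R} (hf : spectrum E f = ∅) {p : E[X]} (hp : p ≠ 0) :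
    IsUnit (aeval f p) := by
  rw [(IsAlgClosed.splits p).eq_prod_roots, map_mul, aeval_C]
  refine IsUnit.mul ((IsUnit.mk0 _ (leadingCoeff_ne_zero.2 hp)).map _) ?_
  by_contra h
  obtain ⟨k, hk, -⟩ := spectrum.exists_mem_of_not_isUnit_aeval_prod h
  simp [hf] at hk

open Polynomial in
/-- If `f` has empty spectrum, the vectors `(f - c)⁻¹ m` for a fixed nonzero `m` are linearly
independent. -/
theorem linearIndependent_of_sub_smul_apply_eq {E M : Type*} [Field E] [IsAlgClosed E]
    [AddCommGroup M] [Module E M] {f : Module.End E M} (hf : spectrum E f = ∅)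
    {m : M} (hm : m ≠ 0) {w : E → M} (hw : ∀ c, f (w c) - c • w c = m) :
    LinearIndependent E w := by
  classical
  rw [linearIndependent_iff']
  intro s a hs c hc
  by_contra hac
  set p : E[X] := ∑ i ∈ s, C (a i) * ∏ j ∈ s.erase i, (X - C j) with hp
  have hp0 : p ≠ 0 := by
    intro h
    have h1 : p.eval c = a c * ∏ j ∈ s.erase c, (c - j) := by
      rw [hp, eval_finsetSum, Finset.sum_eq_single_of_mem c hc]
      · simp [eval_prod]
      · intro b _ hbc
        have : c ∈ s.erase b := Finset.mem_erase.2 ⟨hbc.symm, hc⟩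
        simp [eval_prod, Finset.prod_eq_zero this]
    rw [h, eval_zero, eq_comm, mul_eq_zero, Finset.prod_eq_zero_iff] at h1
    obtain h1 | ⟨j, hj, hcj⟩ := h1
    · exact hac h1
    · exact (Finset.mem_erase.1 hj).1 (sub_eq_zero.1 hcj).symm
  have hpm : aeval f p m = 0 := by
    have key : ∀ i ∈ s, aeval f (C (a i) * ∏ j ∈ s.erase i, (X - C j)) m =
        aeval f (∏ j ∈ s, (X - C j)) (a i • w i) := by
      intro i hi
      rw [← Finset.prod_erase_mul s _ hi, map_mul, map_mul, Module.End.mul_apply,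
        Module.End.mul_apply, map_smul, map_smul]
      simp [← hw i, Module.algebraMap_end_apply]
    rw [hp, map_sum, LinearMap.sum_apply, Finset.sum_congr rfl key, ← map_sum, hs, map_zero]
  have hinj := ((Module.End.isUnit_iff _).1 (isUnit_aeval_of_spectrum_eq_empty hf hp0)).1
  exact hm (hinj (hpm.trans (map_zero _).symm))

/-- An endomorphism of a nonzero vector space of countable dimension over an uncountable
algebraically closed field has nonempty spectrum. -/
theorem spectrum_nonempty_of_rank_le_aleph0 {E M : Type*} [Field E] [IsAlgClosed E]
    [Uncountable E] [AddCommGroup M] [Module E M] [Nontrivial M]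
    (hdim : Module.rank E M ≤ Cardinal.aleph0) (f : Module.End E M) :
    (spectrum E f).Nonempty := by
  by_contra! hf
  obtain ⟨m, hm⟩ := exists_ne (0 : M)
  have hsurj : ∀ c : E, ∃ w : M, f w - c • w = m := by
    intro c
    have hc : IsUnit (algebraMap E (Module.End E M) c - f) := by
      rw [← spectrum.notMem_iff, hf]
      exact Set.notMem_empty c
    obtain ⟨w, hw⟩ := ((Module.End.isUnit_iff _).1 hc).2 (-m)
    refine ⟨w, ?_⟩
    rw [← neg_inj, ← hw]
    simp [Module.algebraMap_end_apply]
  choose w hw using hsurj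
  have h := (linearIndependent_of_sub_smul_apply_eq hf hm hw).cardinal_lift_le_rank
  have h' := h.trans (Cardinal.lift_le.2 hdim)
  rw [Cardinal.lift_aleph0, Cardinal.lift_le_aleph0] at h'
  exact not_countable (α := E) (Cardinal.mk_le_aleph0_iff.1 h')

/-- **Schur's lemma over uncountable algebraically closed fields.**
If `E` is an uncountable algebraically closed field, `A` an `E`-algebra and `M` a simple
`A`-module of countable dimension over `E`, then every `A`-module endomorphism of `M`
is multiplication by a scalar in `E`. -/
theorem schur_scalar_of_countable_rank
    (E : Type*) [Field E] [IsAlgClosed E] [Uncountable E]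
    (A : Type*) [Ring A] [Algebra E A]
    (M : Type*) [AddCommGroup M] [Module A M] [Module E M] [IsScalarTower E A M]
    [IsSimpleModule A M]
    (hdim : Module.rank E M ≤ Cardinal.aleph0)
    (φ : M →ₗ[A] M) :
    ∃ c : E, ∀ m : M, φ m = c • m := by
  have : Nontrivial M := IsSimpleModule.nontrivial A M
  obtain ⟨c, hc⟩ := spectrum_nonempty_of_rank_le_aleph0 hdim (φ.restrictScalars E)
  refine ⟨c, fun m => ?_⟩
  have : SMulCommClass A E M := IsScalarTower.to_smulCommClass'
  obtain h | h := (c • (LinearMap.id : M →ₗ[A] M) - φ).bijective_or_eq_zero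
  · refine absurd ((Module.End.isUnit_iff _).2 ?_) hc
    exact h
  · exact (sub_eq_zero.1 (DFunLike.congr_fun h m)).symm
end

section
/- Let E be a field with at least 3 elements and let Ẽ be a field extension of E whose dimension over E is at most countable (for instance, Ẽ of countable cardinality). Then there exists a family λ : ℤ → Ẽ^× of nonzero elements such that λ₀ = 1, λᵢ ≠ 1 for all i ≠ 0, and the E-linear span of the set of partial products { ∏_{j=0}^{m-1} λⱼ : m ≥ 1 } is all of Ẽ. -/
/-- A nonzero vector space of at most countable dimension is spanned by a sequence of
nonzero vectors. -/
theorem exists_seq_ne_zero_span_eq_top {K V : Type*} [Field K] [AddCommGroup V] [Module K V]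
    [Nontrivial V] (hdim : Module.rank K V ≤ Cardinal.aleph0) :
    ∃ b : ℕ → V, (∀ n, b n ≠ 0) ∧ Submodule.span K (Set.range b) = ⊤ := by
  let B := Module.Basis.ofVectorSpace K V
  have : Countable (Module.Basis.ofVectorSpaceIndex K V) := by
    rw [← Cardinal.mk_le_aleph0_iff, B.mk_eq_rank'']
    exact hdim
  have : Nonempty (Module.Basis.ofVectorSpaceIndex K V) := B.index_nonempty
  obtain ⟨f, hf⟩ := exists_surjective_nat (Module.Basis.ofVectorSpaceIndex K V)
  exact ⟨B ∘ f, fun n => B.ne_zero _, by rw [hf.range_comp, B.span_eq]⟩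

/-- Given `c ≠ 1` and a sequence `b` in a group, there is a sequence starting at `1`,
without consecutive repetitions, whose `(n + 1)`-st term is `b n` or `c * b n`. -/
theorem exists_seq_succ_ne {G : Type*} [Group G] {c : G} (hc : c ≠ 1) (b : ℕ → G) :
    ∃ p : ℕ → G, p 0 = 1 ∧ ∀ n, p (n + 1) ≠ p n ∧ (p (n + 1) = b n ∨ p (n + 1) = c * b n) := by
  classical
  refine ⟨fun n => Nat.rec 1 (fun k q => if b k = q then c * b k else b k) n, rfl, fun n => ?_⟩
  dsimp only
  split_ifs with h
  · exact ⟨by rw [← h]; simpa using hc, Or.inr rfl⟩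
  · exact ⟨h, Or.inl rfl⟩

/-- If `E` is a field with at least `3` elements and `Ẽ/E` a field extension of
dimension at most `ℵ₀`, then there is a family `λ : ℤ → Ẽˣ` with `λ₀ = 1`, `λᵢ ≠ 1`
for `i ≠ 0`, whose partial products `λ₀ ⋯ λ_{m-1}` (for `m ≥ 1`) span `Ẽ` over `E`. -/
theorem exists_lambda_family
    (E : Type*) [Field E] (Et : Type*) [Field Et] [Algebra E Et]
    (hE : 3 ≤ Cardinal.mk E) (hdim : Module.rank E Et ≤ Cardinal.aleph0) :
    ∃ l : ℤ → Etˣ, l 0 = 1 ∧ (∀ i : ℤ, i ≠ 0 → l i ≠ 1) ∧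
      Submodule.span E
        {x : Et | ∃ m : ℕ, 1 ≤ m ∧ x = ∏ j ∈ Finset.range m, (l (j : ℤ) : Et)} = ⊤ := by
  obtain ⟨c, hc0, hc1⟩ := Cardinal.exists_ne_ne_of_three_le hE 0 1
  obtain ⟨b, hb0, hb⟩ := exists_seq_ne_zero_span_eq_top hdim
  let u : Etˣ := Units.map (algebraMap E Et).toMonoidHom (Units.mk0 c hc0)
  have hu : u ≠ 1 := by
    intro h
    apply hc1
    apply (algebraMap E Et).injective
    simpa [u] using congrArg Units.val h
  obtain ⟨p, hp0, hp⟩ := exists_seq_succ_ne hu fun n => Units.mk0 (b n) (hb0 n)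
  let l : ℤ → Etˣ
    | .ofNat 0 => 1
    | .ofNat (n + 1) => p (n + 1) / p n
    | .negSucc _ => u
  have hprod (n : ℕ) : ∏ j ∈ Finset.range (n + 1), (l (j : ℤ) : Et) = p n := by
    induction n with
    | zero => simp [hp0, show l 0 = 1 from rfl]
    | succ n ih =>
      rw [Finset.prod_range_succ, ih,
        show l ((n + 1 : ℕ) : ℤ) = p (n + 1) / p n from rfl, ← Units.val_mul, mul_div_cancel]
  refine ⟨l, rfl, ?_, ?_⟩
  · rintro ((_ | n) | n) hi
    · exact absurd rfl hi
    · exact div_ne_one.mpr (hp n).1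
    · exact hu
  · rw [eq_top_iff, ← hb, Submodule.span_le]
    rintro _ ⟨n, rfl⟩
    have hmem : (p (n + 1) : Et) ∈ Submodule.span E
        {x : Et | ∃ m : ℕ, 1 ≤ m ∧ x = ∏ j ∈ Finset.range m, (l (j : ℤ) : Et)} :=
      Submodule.subset_span ⟨n + 2, by omega, (hprod (n + 1)).symm⟩
    rcases (hp n).2 with h | h
    · simpa [h] using hmem
    · have hsmul : (p (n + 1) : Et) = c • b n := by
        rw [h, Algebra.smul_def]
        rfl
      rw [hsmul] at hmem
      exact (Submodule.smul_mem_iff _ hc0).mp hmem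
end

section
/- Let E ⊆ Ẽ be fields and λ : ℤ → Ẽ^× a family of nonzero elements with λ₀ ∈ E and λᵢ ≠ λ₀ for all i ≠ 0. On the E-vector space ℤ →₀ Ẽ of finitely supported functions from ℤ to Ẽ, define the E-linear operators T₋ and T₊ by (T₋ c)(i) = c(i+1) and (T₊ c)(i) = λ_{i-1}·c(i-1). If W is an E-subspace of ℤ →₀ Ẽ with T₋(W) ⊆ W and T₊(W) ⊆ W and W ≠ 0, then W contains a nonzero element supported on the singleton {0}, i.e. a nonzero scalar multiple x·δ₀ with x ∈ Ẽ, x ≠ 0. -/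
/-- Transporting a finitely supported function along a permutation of the index set and rescaling
its values by units preserves the size of the support. -/
theorem Finsupp.exists_equiv_smul_card_support_eq {ι R : Type*} [Field R] (e : ι ≃ ι)
    (u : ι → Rˣ) (c : ι →₀ R) :
    ∃ d : ι →₀ R, (∀ i, d i = u i * c (e i)) ∧ d.support.card = c.support.card := by
  classical
  let d : ι →₀ R := Finsupp.onFinset (c.support.map e.symm.toEmbedding) (fun i => u i * c (e i))
    (by
      intro i hi
      simpa using right_ne_zero_of_mul hi)
  refine ⟨d, fun i => rfl, ?_⟩
  have hsupp : d.support = c.support.map e.symm.toEmbedding := by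
    ext i
    simp [d]
  rw [hsupp, Finset.card_map]

/-- A subspace stable under the two shifts contains, along with `c`, an element with a support of
the same size which meets `0`, provided `c` does not vanish at `n`. -/
theorem exists_mem_apply_zero_ne_zero_of_shift_stable
    {E Et : Type*} [Field E] [Field Et] [Algebra E Et] (l : ℤ → Etˣ)
    (W : Submodule E (ℤ →₀ Et))
    (hWminus : ∀ c ∈ W, ∀ d : ℤ →₀ Et, (∀ i : ℤ, d i = c (i + 1)) → d ∈ W)
    (hWplus : ∀ c ∈ W, ∀ d : ℤ →₀ Et, (∀ i : ℤ, d i = (l (i - 1) : Et) * c (i - 1)) → d ∈ W)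
    (n : ℤ) : ∀ c ∈ W, c n ≠ 0 →
      ∃ d ∈ W, d 0 ≠ 0 ∧ d.support.card = c.support.card := by
  induction n using Int.induction_on with
  | zero => exact fun c hc hn => ⟨c, hc, hn, rfl⟩
  | succ k ih =>
    intro c hc hn
    obtain ⟨d, hd, hcard⟩ :=
      Finsupp.exists_equiv_smul_card_support_eq (Equiv.addRight (1 : ℤ)) (fun _ => 1) c
    have hdW : d ∈ W := hWminus c hc d fun i => by simp [hd]
    rw [← hcard]
    exact ih d hdW (by simpa [hd] using hn)
  | pred k ih =>
    intro c hc hn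
    obtain ⟨d, hd, hcard⟩ :=
      Finsupp.exists_equiv_smul_card_support_eq (Equiv.subRight (1 : ℤ)) (fun i => l (i - 1)) c
    have hdW : d ∈ W := hWplus c hc d fun i => by simp [hd]
    rw [← hcard]
    exact ih d hdW (by simpa [hd] using hn)

/-- Let `E ⊆ Ẽ` be fields and `λ : ℤ → Ẽˣ` with `λ₀ ∈ E` and `λᵢ ≠ λ₀` for `i ≠ 0`.
If a nonzero `E`-subspace `W` of the finitely supported functions `ℤ →₀ Ẽ` is stable
under the shift `(T₋ c)(i) = c (i+1)` and the twisted shift `(T₊ c)(i) = λ_{i-1} · c (i-1)`,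
then `W` contains a nonzero element supported at `0`. -/
theorem stable_subspace_contains_delta_zero
    (E : Type*) [Field E] (Et : Type*) [Field Et] [Algebra E Et]
    (l : ℤ → Etˣ)
    (h0 : (l 0 : Et) ∈ (algebraMap E Et).range)
    (hne : ∀ i : ℤ, i ≠ 0 → l i ≠ l 0)
    (W : Submodule E (ℤ →₀ Et))
    (hWminus : ∀ c ∈ W, ∀ d : ℤ →₀ Et, (∀ i : ℤ, d i = c (i + 1)) → d ∈ W)
    (hWplus : ∀ c ∈ W, ∀ d : ℤ →₀ Et, (∀ i : ℤ, d i = (l (i - 1) : Et) * c (i - 1)) → d ∈ W)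
    (hW : W ≠ ⊥) :
    ∃ x : Et, x ≠ 0 ∧ Finsupp.single (0 : ℤ) x ∈ W := by
  classical
  obtain ⟨r, hr⟩ := h0
  suffices key : ∀ (m : ℕ), ∀ c ∈ W, c ≠ 0 → c.support.card = m →
      ∃ x : Et, x ≠ 0 ∧ Finsupp.single (0 : ℤ) x ∈ W by
    obtain ⟨c, hc, hc0⟩ := W.exists_mem_ne_zero_of_ne_bot hW
    exact key _ c hc hc0 rfl
  intro m
  induction m using Nat.strong_induction_on with
  | _ m ih =>
    intro c hc hc0 hm
    obtain ⟨n, hn⟩ := Finsupp.ne_iff.mp hc0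
    obtain ⟨d, hdW, hd0, hcard⟩ :=
      exists_mem_apply_zero_ne_zero_of_shift_stable l W hWminus hWplus n c hc hn
    obtain ⟨p, hp, -⟩ := Finsupp.exists_equiv_smul_card_support_eq
      (Equiv.subRight (1 : ℤ)) (fun i => l (i - 1)) d
    have hpW : p ∈ W := hWplus d hdW p fun i => by simp [hp]
    obtain ⟨q, hq, -⟩ := Finsupp.exists_equiv_smul_card_support_eq
      (Equiv.refl ℤ) l d
    have hqW : q ∈ W := hWminus p hpW q fun i => by simp [hp, hq]
    have hf : ∀ i, (q - r • d) i = ((l i : Et) - l 0) * d i := fun i => by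
      simp [hq, Algebra.smul_def, hr, sub_mul]
    have hfW : q - r • d ∈ W := W.sub_mem hqW (W.smul_mem r hdW)
    by_cases hf0 : q - r • d = 0
    · refine ⟨d 0, hd0, ?_⟩
      convert hdW
      ext i
      rcases eq_or_ne i 0 with rfl | hi
      · simp
      · have h := hf i
        rw [hf0, Finsupp.zero_apply, eq_comm, mul_eq_zero, sub_eq_zero] at h
        rw [Finsupp.single_eq_of_ne hi, h.resolve_left fun h => hne i hi (Units.ext h)]
    · refine ih _ ?_ _ hfW hf0 rfl
      rw [← hm, ← hcard]
      refine Finset.card_lt_card (Finset.ssubset_iff_of_subset ?_ |>.mpr ⟨0, ?_, ?_⟩)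
      · intro i hi
        rw [Finsupp.mem_support_iff, hf] at hi
        exact Finsupp.mem_support_iff.mpr (right_ne_zero_of_mul hi)
      · simpa using hd0
      · rw [Finsupp.mem_support_iff, hf]
        simp
end

section
/- Let E ⊆ Ẽ be fields and λ : ℤ → Ẽ^× a family of nonzero elements such that the E-linear span of { ∏_{j=0}^{m-1} λⱼ : m ≥ 1 } equals Ẽ. On the E-vector space ℤ →₀ Ẽ of finitely supported functions, define T₋ and T₊ by (T₋ c)(i) = c(i+1) and (T₊ c)(i) = λ_{i-1}·c(i-1). If W is an E-subspace with T₋(W) ⊆ W and T₊(W) ⊆ W which contains c·δ₀ for some nonzero c ∈ Ẽ, then W contains x·δ₀ for every x ∈ Ẽ. -/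
/-- A subspace stable under `(T₋ c)(i) = c (i+1)` that contains `x · δ_m` contains `x · δ₀`. -/
lemma single_zero_mem_of_single_natCast_mem
    {R M : Type*} [Semiring R] [AddCommMonoid M] [Module R M] {W : Submodule R (ℤ →₀ M)}
    (hW : ∀ c ∈ W, ∀ d : ℤ →₀ M, (∀ i : ℤ, d i = c (i + 1)) → d ∈ W) {x : M} (m : ℕ)
    (hx : Finsupp.single (m : ℤ) x ∈ W) : Finsupp.single (0 : ℤ) x ∈ W := by
  induction m with
  | zero => simpa using hx
  | succ m ih =>
    refine ih (hW _ hx _ fun i => ?_)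
    simp [Finsupp.single_apply]

/-- A subspace stable under `(T₊ c)(i) = a_{i-1} · c (i-1)` that contains `c · δ₀` contains
`(a₀ ⋯ a_{m-1} · c) · δ_m`. -/
lemma single_natCast_prod_mul_mem
    {R A : Type*} [Semiring R] [CommSemiring A] [Module R A] {a : ℤ → A}
    {W : Submodule R (ℤ →₀ A)}
    (hW : ∀ c ∈ W, ∀ d : ℤ →₀ A, (∀ i : ℤ, d i = a (i - 1) * c (i - 1)) → d ∈ W) {c : A}
    (hc : Finsupp.single (0 : ℤ) c ∈ W) (m : ℕ) :
    Finsupp.single (m : ℤ) ((∏ j ∈ Finset.range m, a j) * c) ∈ W := by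
  induction m with
  | zero => simpa using hc
  | succ m ih =>
    refine hW _ ih _ fun i => ?_
    by_cases h : i = m + 1
    · subst h
      simp [Finset.prod_range_succ]
      ring
    · have h' : i - 1 ≠ m := by lia
      simp [Ne.symm h, h'.symm]

/-- Let `E ⊆ Ẽ` be fields and `λ : ℤ → Ẽˣ` whose partial products `λ₀ ⋯ λ_{m-1}`
(for `m ≥ 1`) span `Ẽ` over `E`. If an `E`-subspace `W` of `ℤ →₀ Ẽ` is stable under the
shift `(T₋ c)(i) = c (i+1)` and the twisted shift `(T₊ c)(i) = λ_{i-1} · c (i-1)` and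
contains `c · δ₀` for some nonzero `c`, then `W` contains `x · δ₀` for every `x ∈ Ẽ`. -/
theorem stable_subspace_contains_all_delta_zero
    (E : Type*) [Field E] (Et : Type*) [Field Et] [Algebra E Et]
    (l : ℤ → Etˣ)
    (hspan : Submodule.span E
      {x : Et | ∃ m : ℕ, 1 ≤ m ∧ x = ∏ j ∈ Finset.range m, (l (j : ℤ) : Et)} = ⊤)
    (W : Submodule E (ℤ →₀ Et))
    (hWminus : ∀ c ∈ W, ∀ d : ℤ →₀ Et, (∀ i : ℤ, d i = c (i + 1)) → d ∈ W)
    (hWplus : ∀ c ∈ W, ∀ d : ℤ →₀ Et, (∀ i : ℤ, d i = (l (i - 1) : Et) * c (i - 1)) → d ∈ W)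
    (c : Et) (hc : c ≠ 0) (hcW : Finsupp.single (0 : ℤ) c ∈ W) :
    ∀ x : Et, Finsupp.single (0 : ℤ) x ∈ W := by
  have hle : Submodule.span E
      {x : Et | ∃ m : ℕ, 1 ≤ m ∧ x = ∏ j ∈ Finset.range m, (l (j : ℤ) : Et)} ≤
      W.comap (Finsupp.lsingle (0 : ℤ) ∘ₗ LinearMap.mulRight E c) := by
    rw [Submodule.span_le]
    rintro _ ⟨m, -, rfl⟩
    exact single_zero_mem_of_single_natCast_mem hWminus m
      (single_natCast_prod_mul_mem (a := fun i => (l i : Et)) hWplus hcW m)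
  intro x
  have hx := hle (hspan ▸ Submodule.mem_top : x * c⁻¹ ∈ _)
  simpa [hc] using hx
end

section
/- Let E ⊆ Ẽ be fields and λ : ℤ → Ẽ^× a family of nonzero elements such that λ₀ ∈ E, λᵢ ≠ λ₀ for all i ≠ 0, and the E-linear span of { ∏_{j=0}^{m-1} λⱼ : m ≥ 1 } equals Ẽ. On the E-vector space ℤ →₀ Ẽ of finitely supported functions, define T₋ and T₊ by (T₋ c)(i) = c(i+1) and (T₊ c)(i) = λ_{i-1}·c(i-1). Then every nonzero E-subspace W of ℤ →₀ Ẽ satisfying T₋(W) ⊆ W and T₊(W) ⊆ W is equal to all of ℤ →₀ Ẽ. -/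
/-- A translate of a finitely supported function on `ℤ`, rescaled pointwise by units, is again
finitely supported, and its support is the translate of the original support. -/
theorem exists_translate_mul {K : Type*} [Field K] (u : ℤ → Kˣ) (c : ℤ →₀ K) (n : ℤ) :
    ∃ d : ℤ →₀ K, (∀ i, d i = u i * c (i - n)) ∧ ∀ i, i ∈ d.support ↔ i - n ∈ c.support := by
  have hsupp : ∀ i, (u i : K) * c (i - n) ≠ 0 → i ∈ c.support.map (addRightEmbedding n) := by
    intro i hi
    simp only [Finset.mem_map, addRightEmbedding_apply, Finsupp.mem_support_iff]
    exact ⟨i - n, right_ne_zero_of_mul hi, by ring⟩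
  exact ⟨Finsupp.onFinset _ _ hsupp, fun _ => rfl, fun i => by simp⟩

section StableSubspace

variable {E Et : Type*} [Field E] [Field Et] [Algebra E Et] {l : ℤ → Etˣ}
  {W : Submodule E (ℤ →₀ Et)}

theorem exists_mem_support_translate
    (hWminus : ∀ c ∈ W, ∀ d : ℤ →₀ Et, (∀ i : ℤ, d i = c (i + 1)) → d ∈ W)
    (hWplus : ∀ c ∈ W, ∀ d : ℤ →₀ Et, (∀ i : ℤ, d i = (l (i - 1) : Et) * c (i - 1)) → d ∈ W)
    {c : ℤ →₀ Et} (hc : c ∈ W) (n : ℤ) :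
    ∃ d ∈ W, ∀ i, i ∈ d.support ↔ i - n ∈ c.support := by
  induction n using Int.induction_on with
  | zero => exact ⟨c, hc, by simp⟩
  | succ n ih =>
    obtain ⟨d, hd, hds⟩ := ih
    obtain ⟨e, he, hes⟩ := exists_translate_mul (fun i => l (i - 1)) d 1
    exact ⟨e, hWplus d hd e he, fun i => by rw [hes, hds, sub_sub, add_comm]⟩
  | pred n ih =>
    obtain ⟨d, hd, hds⟩ := ih
    obtain ⟨e, he, hes⟩ := exists_translate_mul (fun _ => (1 : Etˣ)) d (-1)
    exact ⟨e, hWminus d hd e (by simpa using he), fun i => by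
      rw [hes, hds]; ring_nf⟩

theorem mem_of_forall_eq_mul
    (hWminus : ∀ c ∈ W, ∀ d : ℤ →₀ Et, (∀ i : ℤ, d i = c (i + 1)) → d ∈ W)
    (hWplus : ∀ c ∈ W, ∀ d : ℤ →₀ Et, (∀ i : ℤ, d i = (l (i - 1) : Et) * c (i - 1)) → d ∈ W)
    {c d : ℤ →₀ Et} (hc : c ∈ W) (hd : ∀ i, d i = l i * c i) : d ∈ W := by
  obtain ⟨e, he, -⟩ := exists_translate_mul (fun i => l (i - 1)) c 1
  exact hWminus e (hWplus c hc e he) d fun i => by simp [hd, he]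

theorem single_sub_one_mem
    (hWminus : ∀ c ∈ W, ∀ d : ℤ →₀ Et, (∀ i : ℤ, d i = c (i + 1)) → d ∈ W)
    {n : ℤ} {x : Et} (hx : Finsupp.single n x ∈ W) : Finsupp.single (n - 1) x ∈ W :=
  hWminus _ hx _ fun i => by simp only [Finsupp.single_apply, sub_eq_iff_eq_add]

theorem single_add_one_mem
    (hWplus : ∀ c ∈ W, ∀ d : ℤ →₀ Et, (∀ i : ℤ, d i = (l (i - 1) : Et) * c (i - 1)) → d ∈ W)
    {n : ℤ} {x : Et} (hx : Finsupp.single n x ∈ W) :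
    Finsupp.single (n + 1) (l n * x) ∈ W :=
  hWplus _ hx _ fun i => by
    by_cases h : n + 1 = i
    · subst h; simp
    · rw [Finsupp.single_eq_of_ne' h, Finsupp.single_eq_of_ne' (by omega), mul_zero]

/-- A nonzero vector of minimal support can be moved so that its support contains `0`; it is then
killed by the operator `c ↦ (l i - l 0) * c i`, so it is supported at `0`. -/
theorem exists_single_zero_mem
    (h0 : (l 0 : Et) ∈ (algebraMap E Et).range)
    (hne : ∀ i : ℤ, i ≠ 0 → l i ≠ l 0)
    (hWminus : ∀ c ∈ W, ∀ d : ℤ →₀ Et, (∀ i : ℤ, d i = c (i + 1)) → d ∈ W)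
    (hWplus : ∀ c ∈ W, ∀ d : ℤ →₀ Et, (∀ i : ℤ, d i = (l (i - 1) : Et) * c (i - 1)) → d ∈ W)
    {c : ℤ →₀ Et} (hc : c ∈ W) (hc0 : c ≠ 0) :
    ∃ x : Et, x ≠ 0 ∧ Finsupp.single 0 x ∈ W := by
  induction hn : c.support.card using Nat.strong_induction_on generalizing c with
  | _ n ih =>
    obtain ⟨k, hk⟩ := Finsupp.support_nonempty_iff.2 hc0
    obtain ⟨d, hd, hds⟩ := exists_mem_support_translate hWminus hWplus hc (-k)
    have hd0 : (0 : ℤ) ∈ d.support := by simpa [hds] using hk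
    have hcard : d.support.card = n := by
      rw [← hn, ← Finset.card_map (addRightEmbedding (-k)) (s := c.support)]
      congr 1
      ext i
      rw [hds, Finset.mem_map]
      exact ⟨fun h => ⟨_, h, by simp⟩, by rintro ⟨j, hj, rfl⟩; simpa using hj⟩
    obtain ⟨a, ha⟩ := h0
    obtain ⟨e, he, -⟩ := exists_translate_mul l d 0
    have heW : e ∈ W := mem_of_forall_eq_mul hWminus hWplus hd (by simpa using he)
    have hf : ∀ i, (e - a • d) i = (l i - l 0) * d i := fun i => by
      simp [he, ← ha, Algebra.smul_def, sub_mul]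
    by_cases hf0 : e - a • d = 0
    · refine ⟨d 0, Finsupp.mem_support_iff.1 hd0, ?_⟩
      convert hd
      ext i
      by_cases hi : i = 0
      · simp [hi]
      · have h := hf i
        rw [hf0, Finsupp.zero_apply, eq_comm, mul_eq_zero, sub_eq_zero] at h
        rw [Finsupp.single_eq_of_ne hi]
        exact (h.resolve_left fun h' => hne i hi (Units.ext h')).symm
    · refine ih _ ?_ (W.sub_mem heW (W.smul_mem a hd)) hf0 rfl
      rw [← hcard]
      refine Finset.card_lt_card ⟨fun i hi => ?_, fun h => ?_⟩
      · rw [Finsupp.mem_support_iff, hf] at hi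
        exact Finsupp.mem_support_iff.2 (right_ne_zero_of_mul hi)
      · exact Finsupp.mem_support_iff.1 (h hd0) (by rw [hf, sub_self, zero_mul])

theorem single_zero_prod_mul_mem
    (hWminus : ∀ c ∈ W, ∀ d : ℤ →₀ Et, (∀ i : ℤ, d i = c (i + 1)) → d ∈ W)
    (hWplus : ∀ c ∈ W, ∀ d : ℤ →₀ Et, (∀ i : ℤ, d i = (l (i - 1) : Et) * c (i - 1)) → d ∈ W)
    {x : Et} (hx : Finsupp.single 0 x ∈ W) (m : ℕ) :
    Finsupp.single 0 ((∏ j ∈ Finset.range m, (l (j : ℤ) : Et)) * x) ∈ W := by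
  have up : Finsupp.single (m : ℤ) ((∏ j ∈ Finset.range m, (l (j : ℤ) : Et)) * x) ∈ W := by
    induction m with
    | zero => simpa using hx
    | succ m ih =>
      rw [Finset.prod_range_succ_comm, mul_assoc, Nat.cast_succ]
      exact single_add_one_mem hWplus ih
  have down : ∀ (k : ℕ) (y : Et), Finsupp.single (k : ℤ) y ∈ W → Finsupp.single 0 y ∈ W := by
    intro k y
    induction k with
    | zero => simp
    | succ k ih => exact fun h => ih (by simpa using single_sub_one_mem hWminus h)
  exact down m _ up

end StableSubspace

/-- **Irreducibility of the diagram `D(λ)` (linear-algebra core).**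
Let `E ⊆ Ẽ` be fields and `λ : ℤ → Ẽˣ` with `λ₀ ∈ E`, `λᵢ ≠ λ₀` for `i ≠ 0`, and whose
partial products `λ₀ ⋯ λ_{m-1}` (for `m ≥ 1`) span `Ẽ` over `E`. Then every nonzero
`E`-subspace of `ℤ →₀ Ẽ` stable under the shift `(T₋ c)(i) = c (i+1)` and the twisted
shift `(T₊ c)(i) = λ_{i-1} · c (i-1)` is the whole space. -/
theorem stable_subspace_eq_top
    (E : Type*) [Field E] (Et : Type*) [Field Et] [Algebra E Et]
    (l : ℤ → Etˣ)
    (h0 : (l 0 : Et) ∈ (algebraMap E Et).range)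
    (hne : ∀ i : ℤ, i ≠ 0 → l i ≠ l 0)
    (hspan : Submodule.span E
      {x : Et | ∃ m : ℕ, 1 ≤ m ∧ x = ∏ j ∈ Finset.range m, (l (j : ℤ) : Et)} = ⊤)
    (W : Submodule E (ℤ →₀ Et))
    (hWminus : ∀ c ∈ W, ∀ d : ℤ →₀ Et, (∀ i : ℤ, d i = c (i + 1)) → d ∈ W)
    (hWplus : ∀ c ∈ W, ∀ d : ℤ →₀ Et, (∀ i : ℤ, d i = (l (i - 1) : Et) * c (i - 1)) → d ∈ W)
    (hW : W ≠ ⊥) :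
    W = ⊤ := by
  obtain ⟨c, hc, hc0⟩ := W.ne_bot_iff.1 hW
  obtain ⟨x, hx0, hx⟩ := exists_single_zero_mem h0 hne hWminus hWplus hc hc0
  have hzero : ∀ y : Et, Finsupp.single 0 y ∈ W := by
    have key : ∀ z : Et, Finsupp.single 0 (z * x) ∈ W := fun z => by
      have hz : z ∈ Submodule.span E
          {x : Et | ∃ m : ℕ, 1 ≤ m ∧ x = ∏ j ∈ Finset.range m, (l (j : ℤ) : Et)} :=
        hspan ▸ Submodule.mem_top
      induction hz using Submodule.span_induction with
      | mem z hz =>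
        obtain ⟨m, -, rfl⟩ := hz
        exact single_zero_prod_mul_mem hWminus hWplus hx m
      | zero => simp
      | add a b _ _ ha hb =>
        rw [add_mul, Finsupp.single_add]
        exact W.add_mem ha hb
      | smul a z _ hz =>
        rw [smul_mul_assoc, ← Finsupp.smul_single]
        exact W.smul_mem a hz
    exact fun y => by simpa [hx0] using key (y * x⁻¹)
  have hsingle : ∀ (n : ℤ) (y : Et), Finsupp.single n y ∈ W := by
    intro n
    induction n using Int.induction_on with
    | zero => exact hzero
    | succ n ih =>
      exact fun y => by simpa using single_add_one_mem hWplus (ih ((l n : Et)⁻¹ * y))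
    | pred n ih => exact fun y => single_sub_one_mem hWminus (ih y)
  refine eq_top_iff.2 fun f _ => ?_
  induction f using Finsupp.induction_linear with
  | zero => exact W.zero_mem
  | add f g hf hg => exact W.add_mem (hf trivial) (hg trivial)
  | single n y => exact hsingle n y
end
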